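/- Plugging of rewrites is a special case of sequential merging: for every plugging p of rewrites r₁ : L₁ → R₁ and r₂ : L₂ → R₂, there exists merging data q such that the parallel composition r₁ ⊙_p r₂ equals the sequential merging r₁ ;_q r₂. -/

import Mathlib

open CategoryTheory

/-- A pre-open graph: a set of edges, vertices and edge-points, with source and
target maps into the disjoint union of vertices and edge-points. -/
structure POG : Type 1 where
  E : Type
  V : Type
  Eps : Type
  s : E → V ⊕ Eps
  t : E → V ⊕ Eps

namespace POG

/-- A pre-open graph is an open graph when every edge-point is the source of at
most one edge and the target of at most one edge. -/
def IsOpen (G : POG) : Prop :=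
  (∀ e e' p, G.s e = Sum.inr p → G.s e' = Sum.inr p → e = e') ∧
  (∀ e e' p, G.t e = Sum.inr p → G.t e' = Sum.inr p → e = e')

def IsFinite (G : POG) : Prop := Finite G.E ∧ Finite G.V ∧ Finite G.Eps

/-- The edge-point `p` has an in-edge. -/
def HasIn (G : POG) (p : G.Eps) : Prop := ∃ e, G.t e = Sum.inr p

/-- The edge-point `p` has an out-edge. -/
def HasOut (G : POG) (p : G.Eps) : Prop := ∃ e, G.s e = Sum.inr p

/-- An input: an edge-point with an out-edge and no in-edge. -/
def IsInput (G : POG) (p : G.Eps) : Prop := G.HasOut p ∧ ¬ G.HasIn p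

/-- An output: an edge-point with an in-edge and no out-edge. -/
def IsOutput (G : POG) (p : G.Eps) : Prop := G.HasIn p ∧ ¬ G.HasOut p

/-- A boundary point is an input or an output. -/
def IsBoundaryPt (G : POG) (p : G.Eps) : Prop := G.IsInput p ∨ G.IsOutput p

/-- An isolated point: no in-edges and no out-edges. -/
def IsIsolated (G : POG) (p : G.Eps) : Prop := ¬ G.HasIn p ∧ ¬ G.HasOut p

/-- A point graph consists solely of (isolated) edge-points: no edges, no vertices. -/
def IsPointGraph (G : POG) : Prop := IsEmpty G.E ∧ IsEmpty G.V

def Inputs (G : POG) : Type := {p : G.Eps // G.IsInput p}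

def Outputs (G : POG) : Type := {p : G.Eps // G.IsOutput p}

/-- Two graphs have the same boundary when their interfaces are isomorphic,
i.e. there are bijections between their inputs and between their outputs. -/
def SameBoundary (G H : POG) : Prop :=
  Nonempty (G.Inputs ≃ H.Inputs) ∧ Nonempty (G.Outputs ≃ H.Outputs)

/-- The tensor product (disjoint union) of two graphs: the merging along the
empty graph. -/
def tensor (G H : POG) : POG where
  E := G.E ⊕ H.E
  V := G.V ⊕ H.V
  Eps := G.Eps ⊕ H.Eps
  s := fun e => match e with
    | Sum.inl e => Sum.map Sum.inl Sum.inl (G.s e)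
    | Sum.inr e => Sum.map Sum.inr Sum.inr (H.s e)
  t := fun e => match e with
    | Sum.inl e => Sum.map Sum.inl Sum.inl (G.t e)
    | Sum.inr e => Sum.map Sum.inr Sum.inr (H.t e)

/-- The one-step contraction of an open graph `G` at an interior edge-point `p`
with (unique) in-edge `e₁` and (unique) out-edge `e₂`: the edges `e₁, e₂` and
the point `p` are replaced by a single fresh edge from the source of `e₁` to
the target of `e₂`. -/
def contract (G : POG) (hG : G.IsOpen) (p : G.Eps) (e₁ e₂ : G.E)
    (h1 : G.t e₁ = Sum.inr p) (h2 : G.s e₂ = Sum.inr p) (hne : e₁ ≠ e₂) : POG where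
  E := {e : G.E // e ≠ e₁ ∧ e ≠ e₂} ⊕ PUnit
  V := G.V
  Eps := {q : G.Eps // q ≠ p}
  s := fun x => match x with
    | Sum.inl ⟨e, he⟩ =>
        match h : G.s e with
        | Sum.inl v => Sum.inl v
        | Sum.inr q => Sum.inr ⟨q, fun hq => he.2 (hG.1 e e₂ p (hq ▸ h) h2)⟩
    | Sum.inr _ =>
        match h : G.s e₁ with
        | Sum.inl v => Sum.inl v
        | Sum.inr q => Sum.inr ⟨q, fun hq => hne (hG.1 e₁ e₂ p (hq ▸ h) h2)⟩
  t := fun x => match x with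
    | Sum.inl ⟨e, he⟩ =>
        match h : G.t e with
        | Sum.inl v => Sum.inl v
        | Sum.inr q => Sum.inr ⟨q, fun hq => he.1 (hG.2 e e₁ p (hq ▸ h) h1)⟩
    | Sum.inr _ =>
        match h : G.t e₂ with
        | Sum.inl v => Sum.inl v
        | Sum.inr q => Sum.inr ⟨q, fun hq => hne ((hG.2 e₂ e₁ p (hq ▸ h) h1).symm)⟩

end POG

/-- A homomorphism of pre-open graphs: maps on edges, vertices and edge-points
commuting with source and target. -/
structure POGHom (G H : POG) : Type where
  edgeMap : G.E → H.E
  vMap : G.V → H.V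
  epMap : G.Eps → H.Eps
  s_comm : ∀ e, H.s (edgeMap e) = Sum.map vMap epMap (G.s e)
  t_comm : ∀ e, H.t (edgeMap e) = Sum.map vMap epMap (G.t e)

namespace POGHom

def id (G : POG) : POGHom G G where
  edgeMap := fun e => e
  vMap := fun v => v
  epMap := fun q => q
  s_comm := fun e => by cases h : G.s e <;> simp [h]
  t_comm := fun e => by cases h : G.t e <;> simp [h]

def comp {G H K : POG} (g : POGHom H K) (f : POGHom G H) : POGHom G K where
  edgeMap := fun e => g.edgeMap (f.edgeMap e)
  vMap := fun v => g.vMap (f.vMap v)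
  epMap := fun q => g.epMap (f.epMap q)
  s_comm := fun e => by rw [g.s_comm, f.s_comm]; cases G.s e <;> rfl
  t_comm := fun e => by rw [g.t_comm, f.t_comm]; cases G.t e <;> rfl

/-- The homomorphism is injective (a monomorphism). -/
def Inj {G H : POG} (f : POGHom G H) : Prop :=
  Function.Injective f.edgeMap ∧ Function.Injective f.vMap ∧ Function.Injective f.epMap

/-- The homomorphism is full on vertices: every edge of the codomain incident to
the image of a vertex is itself in the image. -/
def FullOnVertices {G H : POG} (f : POGHom G H) : Prop :=
  ∀ (v : G.V) (e : H.E),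
    (H.s e = Sum.inl (f.vMap v) ∨ H.t e = Sum.inl (f.vMap v)) → ∃ e₀, f.edgeMap e₀ = e

/-- An open embedding: an injective homomorphism which is full on vertices. -/
def IsEmbedding {G H : POG} (f : POGHom G H) : Prop := f.Inj ∧ f.FullOnVertices

/-- An isomorphism of pre-open graphs. -/
def IsIso {G H : POG} (f : POGHom G H) : Prop :=
  Function.Bijective f.edgeMap ∧ Function.Bijective f.vMap ∧ Function.Bijective f.epMap

end POGHom

/-- `G` and `H` are isomorphic pre-open graphs. -/
def Isomorphic (G H : POG) : Prop := ∃ f : POGHom G H, f.IsIso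

/-- A pair of homomorphisms with common domain is boundary-coherent. -/
def BoundaryCoherent {K G₁ G₂ : POG} (f : POGHom K G₁) (g : POGHom K G₂) : Prop :=
  (∀ p : K.Eps, K.IsBoundaryPt p →
      ¬ G₁.IsBoundaryPt (f.epMap p) → G₂.IsBoundaryPt (g.epMap p)) ∧
  (∀ p : K.Eps, K.IsIsolated p →
      G₁.IsIsolated (f.epMap p) ∨ G₂.IsIsolated (g.epMap p) ∨
      ((G₁.IsInput (f.epMap p) ↔ G₂.IsOutput (g.epMap p)) ∧
       (G₁.IsOutput (f.epMap p) ↔ G₂.IsInput (g.epMap p))))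

/-- `M` together with `i₁, i₂` is the pushout of `e₁, e₂` in the category of
open graphs. -/
def IsPushout {K G₁ G₂ M : POG} (e₁ : POGHom K G₁) (e₂ : POGHom K G₂)
    (i₁ : POGHom G₁ M) (i₂ : POGHom G₂ M) : Prop :=
  M.IsOpen ∧ i₁.comp e₁ = i₂.comp e₂ ∧
  ∀ (N : POG), N.IsOpen → ∀ (j₁ : POGHom G₁ N) (j₂ : POGHom G₂ N),
    j₁.comp e₁ = j₂.comp e₂ → ∃! u : POGHom M N, u.comp i₁ = j₁ ∧ u.comp i₂ = j₂

/-- A merging: the pushout in OGraph of a boundary-coherent pair of open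
embeddings. -/
def IsMergingAt {K G₁ G₂ M : POG} (e₁ : POGHom K G₁) (e₂ : POGHom K G₂)
    (i₁ : POGHom G₁ M) (i₂ : POGHom G₂ M) : Prop :=
  K.IsOpen ∧ G₁.IsOpen ∧ G₂.IsOpen ∧
  e₁.IsEmbedding ∧ e₂.IsEmbedding ∧ BoundaryCoherent e₁ e₂ ∧ IsPushout e₁ e₂ i₁ i₂

/-- A plugging: a merging whose shared graph is a point graph embedded by
boundary embeddings. -/
def IsPluggingAt {K G₁ G₂ M : POG} (e₁ : POGHom K G₁) (e₂ : POGHom K G₂)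
    (i₁ : POGHom G₁ M) (i₂ : POGHom G₂ M) : Prop :=
  IsMergingAt e₁ e₂ i₁ i₂ ∧ K.IsPointGraph ∧
  (∀ q : K.Eps, G₁.IsBoundaryPt (e₁.epMap q)) ∧
  (∀ q : K.Eps, G₂.IsBoundaryPt (e₂.epMap q))

/-- One contraction step, up to isomorphism: `H` is (isomorphic to) the result
of contracting away an interior edge-point of `G`. -/
def StepContract (G H : POG) : Prop :=
  ∃ (hG : G.IsOpen) (p : G.Eps) (e₁ e₂ : G.E) (h1 : G.t e₁ = Sum.inr p)
    (h2 : G.s e₂ = Sum.inr p) (hne : e₁ ≠ e₂),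
    Isomorphic (G.contract hG p e₁ e₂ h1 h2 hne) H

/-- `H ≼ G`: `G` contracts to `H` (in any number of steps, up to isomorphism). -/
def ContractsTo (G H : POG) : Prop :=
  Isomorphic G H ∨ Relation.TransGen StepContract G H

/-- `G ∼ H`: homeomorphism, the symmetric closure of the contraction order. -/
def Homeo (G H : POG) : Prop := ContractsTo G H ∨ ContractsTo H G

/-- A proper (minimal) open graph: minimal with respect to `≼`. -/
def POG.IsProper (G : POG) : Prop :=
  G.IsOpen ∧ ∀ H : POG, ContractsTo G H → Isomorphic G H

/-- `L` matches `G`: there is some `G' ∼ G` and an open embedding of `L` into `G'`. -/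
def Matches (L G : POG) : Prop :=
  ∃ G' : POG, Homeo G' G ∧ ∃ e : POGHom L G', e.IsEmbedding

/-- Transport of a homomorphism out of an edgeless graph along a contraction. -/
def contractTransport {K G : POG} (hKE : IsEmpty K.E) (f : POGHom K G)
    (hG : G.IsOpen) (p : G.Eps) (e₁ e₂ : G.E) (h1 : G.t e₁ = Sum.inr p)
    (h2 : G.s e₂ = Sum.inr p) (hne : e₁ ≠ e₂) (hp : ∀ q, f.epMap q ≠ p) :
    POGHom K (G.contract hG p e₁ e₂ h1 h2 hne) where
  edgeMap := fun e => (hKE.false e).elim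
  vMap := f.vMap
  epMap := fun q => ⟨f.epMap q, hp q⟩
  s_comm := fun e => (hKE.false e).elim
  t_comm := fun e => (hKE.false e).elim

/-- A graph equipped with a homomorphism from a fixed (point) graph `K`. -/
def PointedGraph (K : POG) : Type 1 := Σ G : POG, POGHom K G

/-- One contraction step of a `K`-pointed graph, transporting the distinguished
map along the contraction. -/
def StepContractRel (K : POG) (hKE : IsEmpty K.E) (x y : PointedGraph K) : Prop :=
  ∃ (hG : x.1.IsOpen) (p : x.1.Eps) (e₁ e₂ : x.1.E) (h1 : x.1.t e₁ = Sum.inr p)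
    (h2 : x.1.s e₂ = Sum.inr p) (hne : e₁ ≠ e₂) (hp : ∀ q, x.2.epMap q ≠ p),
    ∃ φ : POGHom (x.1.contract hG p e₁ e₂ h1 h2 hne) y.1,
      φ.IsIso ∧ φ.comp (contractTransport hKE x.2 hG p e₁ e₂ h1 h2 hne hp) = y.2

/-- Isomorphism of `K`-pointed graphs. -/
def IsoRel (K : POG) (x y : PointedGraph K) : Prop :=
  ∃ φ : POGHom x.1 y.1, φ.IsIso ∧ φ.comp x.2 = y.2

/-- Contraction order on `K`-pointed graphs, up to isomorphism. -/
def ContractsToRel (K : POG) (hKE : IsEmpty K.E) (x y : PointedGraph K) : Prop :=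
  IsoRel K x y ∨ Relation.TransGen (StepContractRel K hKE) x y

/-- Homeomorphism of `K`-pointed graphs: `y.1 ∼ x.1`, with the distinguished map
`x.2` "considered as a map into" `y.1` being `y.2`. -/
def HomeoRel (K : POG) (hKE : IsEmpty K.E) (x y : PointedGraph K) : Prop :=
  ContractsToRel K hKE x y ∨ ContractsToRel K hKE y x

/-- A rewrite rule: a pair of open graphs with the same boundary. -/
def IsRewrite (L R : POG) : Prop := L.IsOpen ∧ R.IsOpen ∧ POG.SameBoundary L R

/-- Two pluggings (of the same point graph `P` into the two sides `L`, `R` of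
rewrite rules) correspond: along the identification of the boundaries,
corresponding plugged points have the same input/output status. -/
def PlugCorresponds {P L R : POG} (b : POGHom P L) (c : POGHom P R) : Prop :=
  ∀ q : P.Eps, (L.IsInput (b.epMap q) ↔ R.IsInput (c.epMap q)) ∧
               (L.IsOutput (b.epMap q) ↔ R.IsOutput (c.epMap q))

/-- `M' = M[G ↦ G']ₑ`: substitution of `G'` for `G` in `M` at `e : G → M`,
defined by the pair of pushouts that first compute the subtraction `D = M −ₑ G`
(so that `M` is the plugging of `G` with `D` along the interface point graph
`P`) and then plug `G'` onto `D` along the same interface. -/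
def IsSubstitutionAt (M : POG) {G : POG} (e : POGHom G M) (G' M' : POG) : Prop :=
  ∃ (D P : POG) (b : POGHom P G) (d : POGHom P D) (b' : POGHom P G')
    (iD : POGHom D M) (iG' : POGHom G' M') (iD' : POGHom D M'),
    IsPluggingAt b d e iD ∧ IsPluggingAt b' d iG' iD'

/-- `G` rewrites to `H` by (an extension of) the rule `L → R`:
there are `G'' ∼ G` and a matching `e : L → G''` with `H = G''[L ↦ R]ₑ`. -/
def RewriteStep (L R G H : POG) : Prop :=
  ∃ G'' : POG, Homeo G'' G ∧
    ∃ e : POGHom L G'', e.IsEmbedding ∧ IsSubstitutionAt G'' e R H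

/-- The category of open graphs. -/
abbrev OGraphCat : Type 1 := {G : POG // G.IsOpen}

instance : Category OGraphCat where
  Hom X Y := POGHom X.val Y.val
  id X := POGHom.id X.val
  comp f g := g.comp f
  id_comp := fun _ => rfl
  comp_id := fun _ => rfl
  assoc := fun _ _ _ => rfl

/-- The vertices of the quiver underlying a graphical theory: the generating
set `S` of graphs. -/
abbrev RWQuiver (S : Set POG) (_R : Set (POG × POG)) : Type 1 := {G : POG // G ∈ S}

instance (S : Set POG) (R : Set (POG × POG)) : Quiver (RWQuiver S R) :=
  ⟨fun X Y => PLift ((X.val, Y.val) ∈ R)⟩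

/-- The graphical theory on generators `S` and rewrite rules `R`: the category
whose objects are the graphs in `S` and whose arrows are formal sequential
compositions (paths) of rewrites in `R`. -/
def GThy (S : Set POG) (R : Set (POG × POG)) : Type 1 := Paths (RWQuiver S R)

instance (S : Set POG) (R : Set (POG × POG)) : Category (GThy S R) :=
  inferInstanceAs (Category (Paths (RWQuiver S R)))

def toGThy {S : Set POG} {R : Set (POG × POG)} (X : RWQuiver S R) : GThy S R := X

/-- The tensor product on objects of a graphical theory. -/
def tensorMk {S : Set POG} {R : Set (POG × POG)}
    (hS : ∀ G ∈ S, ∀ H ∈ S, POG.tensor G H ∈ S) (X Y : RWQuiver S R) :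
    RWQuiver S R :=
  ⟨POG.tensor X.val Y.val, hS _ X.property _ Y.property⟩

theorem POGHom.ext_maps {G H : POG} {f g : POGHom G H} (hE : f.edgeMap = g.edgeMap)
    (hV : f.vMap = g.vMap) (hP : f.epMap = g.epMap) : f = g := by
  cases f
  cases g
  simp_all

/-- The inclusion of the edge-points of `G₂` into the edge-points of the gluing of `G₁` and `G₂`
along `K`, where each shared edge-point is represented in `G₁`. -/
noncomputable def glueEp {K G₁ G₂ : POG} (e₁ : POGHom K G₁) (e₂ : POGHom K G₂) (q : G₂.Eps) :
    G₁.Eps ⊕ {q : G₂.Eps // ¬ ∃ k, e₂.epMap k = q} :=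
  open Classical in
  if h : ∃ k, e₂.epMap k = q then Sum.inl (e₁.epMap h.choose) else Sum.inr ⟨q, h⟩

section GlueEp

variable {K G₁ G₂ : POG} {e₁ : POGHom K G₁} {e₂ : POGHom K G₂}

theorem glueEp_apply (h₂ : Function.Injective e₂.epMap) (k : K.Eps) :
    glueEp e₁ e₂ (e₂.epMap k) = Sum.inl (e₁.epMap k) := by
  have h : ∃ k', e₂.epMap k' = e₂.epMap k := ⟨k, rfl⟩
  rw [glueEp, dif_pos h, h₂ h.choose_spec]

theorem glueEp_of_notMem {q : G₂.Eps} (h : ¬ ∃ k, e₂.epMap k = q) :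
    glueEp e₁ e₂ q = Sum.inr ⟨q, h⟩ := dif_neg h

theorem exists_of_glueEp_eq_inl {q : G₂.Eps} {x : G₁.Eps} (h : glueEp e₁ e₂ q = Sum.inl x) :
    ∃ k, e₂.epMap k = q ∧ e₁.epMap k = x := by
  by_cases hq : ∃ k, e₂.epMap k = q
  · rw [glueEp, dif_pos hq] at h
    exact ⟨hq.choose, hq.choose_spec, Sum.inl.inj h⟩
  · rw [glueEp_of_notMem hq] at h
    cases h

theorem glueEp_injective (h₁ : Function.Injective e₁.epMap) :
    Function.Injective (glueEp e₁ e₂) := by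
  intro q q' h
  cases hx : glueEp e₁ e₂ q with
  | inl x =>
    obtain ⟨k, rfl, hk⟩ := exists_of_glueEp_eq_inl hx
    obtain ⟨k', rfl, hk'⟩ := exists_of_glueEp_eq_inl (h ▸ hx)
    rw [h₁ (hk.trans hk'.symm)]
  | inr x =>
    have key : ∀ q, glueEp e₁ e₂ q = Sum.inr x → q = x := by
      intro q hq
      by_cases hk : ∃ k, e₂.epMap k = q
      · rw [glueEp, dif_pos hk] at hq
        cases hq
      · rw [glueEp_of_notMem hk] at hq
        exact congrArg Subtype.val (Sum.inr.inj hq)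
    rw [key q hx, key q' (h ▸ hx)]

end GlueEp

/-- The gluing of `G₁` and `G₂` along a point graph `K`. -/
noncomputable def glue {K G₁ G₂ : POG} (e₁ : POGHom K G₁) (e₂ : POGHom K G₂) : POG where
  E := G₁.E ⊕ G₂.E
  V := G₁.V ⊕ G₂.V
  Eps := G₁.Eps ⊕ {q : G₂.Eps // ¬ ∃ k, e₂.epMap k = q}
  s := Sum.elim (fun e => Sum.map Sum.inl Sum.inl (G₁.s e))
    (fun e => Sum.map Sum.inr (glueEp e₁ e₂) (G₂.s e))
  t := Sum.elim (fun e => Sum.map Sum.inl Sum.inl (G₁.t e))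
    (fun e => Sum.map Sum.inr (glueEp e₁ e₂) (G₂.t e))

noncomputable def glueInl {K G₁ G₂ : POG} (e₁ : POGHom K G₁) (e₂ : POGHom K G₂) :
    POGHom G₁ (glue e₁ e₂) where
  edgeMap := Sum.inl
  vMap := Sum.inl
  epMap := Sum.inl
  s_comm _ := rfl
  t_comm _ := rfl

noncomputable def glueInr {K G₁ G₂ : POG} (e₁ : POGHom K G₁) (e₂ : POGHom K G₂) :
    POGHom G₂ (glue e₁ e₂) where
  edgeMap := Sum.inr
  vMap := Sum.inr
  epMap := glueEp e₁ e₂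
  s_comm _ := rfl
  t_comm _ := rfl

theorem sum_map_eq_inr_iff {α β α' β' : Type*} {f : α → α'} {g : β → β'} {x : α ⊕ β} {y : β'} :
    Sum.map f g x = Sum.inr y ↔ ∃ z, x = Sum.inr z ∧ g z = y := by
  cases x <;> simp

/-- An incidence map on a gluing hits each edge-point at most once if the incidence maps on the
two parts do and no shared edge-point is hit from both sides. -/
theorem glue_incidence_injOn {K G₁ G₂ : POG} {e₁ : POGHom K G₁} {e₂ : POGHom K G₂}
    (h₁ : Function.Injective e₁.epMap)
    {f₁ : G₁.E → G₁.V ⊕ G₁.Eps} {f₂ : G₂.E → G₂.V ⊕ G₂.Eps}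
    (hf₁ : ∀ e e' p, f₁ e = Sum.inr p → f₁ e' = Sum.inr p → e = e')
    (hf₂ : ∀ e e' p, f₂ e = Sum.inr p → f₂ e' = Sum.inr p → e = e')
    (hdisj : ∀ k e e', f₁ e = Sum.inr (e₁.epMap k) → f₂ e' = Sum.inr (e₂.epMap k) → False)
    (e e' : G₁.E ⊕ G₂.E) (p : G₁.Eps ⊕ {q : G₂.Eps // ¬ ∃ k, e₂.epMap k = q})
    (he : Sum.elim (fun e => Sum.map Sum.inl Sum.inl (f₁ e))
      (fun e => Sum.map Sum.inr (glueEp e₁ e₂) (f₂ e)) e =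
        (Sum.inr p : (G₁.V ⊕ G₂.V) ⊕ _))
    (he' : Sum.elim (fun e => Sum.map Sum.inl Sum.inl (f₁ e))
      (fun e => Sum.map Sum.inr (glueEp e₁ e₂) (f₂ e)) e' =
        (Sum.inr p : (G₁.V ⊕ G₂.V) ⊕ _)) :
    e = e' := by
  rcases e with e | e <;> rcases e' with e' | e' <;>
    simp only [Sum.elim_inl, Sum.elim_inr, sum_map_eq_inr_iff] at he he' <;>
    obtain ⟨x, hx, hxp⟩ := he <;> obtain ⟨y, hy, hyp⟩ := he'
  · obtain rfl := Sum.inl_injective (hxp.trans hyp.symm)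
    rw [hf₁ e e' x hx hy]
  · obtain ⟨k, rfl, rfl⟩ := exists_of_glueEp_eq_inl (hyp.trans hxp.symm)
    exact (hdisj k e e' hx hy).elim
  · obtain ⟨k, rfl, rfl⟩ := exists_of_glueEp_eq_inl (hxp.trans hyp.symm)
    exact (hdisj k e' e hy hx).elim
  · obtain rfl := glueEp_injective h₁ (hxp.trans hyp.symm)
    rw [hf₂ e e' x hx hy]

theorem isOpen_glue {K G₁ G₂ : POG} {e₁ : POGHom K G₁} {e₂ : POGHom K G₂}
    (hG₁ : G₁.IsOpen) (hG₂ : G₂.IsOpen) (h₁ : Function.Injective e₁.epMap)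
    (hb : ∀ k, (G₁.IsInput (e₁.epMap k) ∧ G₂.IsOutput (e₂.epMap k)) ∨
      (G₁.IsOutput (e₁.epMap k) ∧ G₂.IsInput (e₂.epMap k))) :
    (glue e₁ e₂).IsOpen := by
  refine ⟨glue_incidence_injOn h₁ hG₁.1 hG₂.1 ?_, glue_incidence_injOn h₁ hG₁.2 hG₂.2 ?_⟩
  · intro k e e' he he'
    rcases hb k with ⟨-, h⟩ | ⟨h, -⟩
    · exact h.2 ⟨e', he'⟩
    · exact h.2 ⟨e, he⟩
  · intro k e e' he he'
    rcases hb k with ⟨h, -⟩ | ⟨-, h⟩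
    · exact h.2 ⟨e, he⟩
    · exact h.2 ⟨e', he'⟩

theorem isPushout_glue {K G₁ G₂ : POG} {e₁ : POGHom K G₁} {e₂ : POGHom K G₂}
    (hK : K.IsPointGraph) (hopen : (glue e₁ e₂).IsOpen) (h₂ : Function.Injective e₂.epMap) :
    IsPushout e₁ e₂ (glueInl e₁ e₂) (glueInr e₁ e₂) := by
  refine ⟨hopen, POGHom.ext_maps (funext fun e => (hK.1.false e).elim)
    (funext fun v => (hK.2.false v).elim) (funext fun k => (glueEp_apply h₂ k).symm), ?_⟩
  intro N _ j₁ j₂ hj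
  have hj_ep : ∀ k, j₁.epMap (e₁.epMap k) = j₂.epMap (e₂.epMap k) :=
    fun k => congrFun (congrArg POGHom.epMap hj) k
  have hglue : ∀ q, Sum.elim j₁.epMap (fun q => j₂.epMap q.1) (glueEp e₁ e₂ q) = j₂.epMap q := by
    intro q
    by_cases hq : ∃ k, e₂.epMap k = q
    · obtain ⟨k, rfl⟩ := hq
      rw [glueEp_apply h₂, Sum.elim_inl, hj_ep]
    · rw [glueEp_of_notMem hq, Sum.elim_inr]
  refine ⟨{ edgeMap := Sum.elim j₁.edgeMap j₂.edgeMap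
            vMap := Sum.elim j₁.vMap j₂.vMap
            epMap := Sum.elim j₁.epMap (fun q => j₂.epMap q.1)
            s_comm := ?_
            t_comm := ?_ }, ⟨?_, ?_⟩, ?_⟩
  · rintro (e | e)
    · simp only [glue, Sum.elim_inl, j₁.s_comm]
      cases G₁.s e <;> rfl
    · simp only [glue, Sum.elim_inr, j₂.s_comm]
      cases G₂.s e <;> simp [hglue]
  · rintro (e | e)
    · simp only [glue, Sum.elim_inl, j₁.t_comm]
      cases G₁.t e <;> rfl
    · simp only [glue, Sum.elim_inr, j₂.t_comm]
      cases G₂.t e <;> simp [hglue]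
  · exact POGHom.ext_maps rfl rfl rfl
  · exact POGHom.ext_maps rfl rfl (funext hglue)
  · rintro u ⟨rfl, rfl⟩
    refine POGHom.ext_maps ?_ ?_ ?_
    · funext e
      cases e <;> rfl
    · funext v
      cases v <;> rfl
    · funext q
      rcases q with q | q
      · rfl
      · exact congrArg u.epMap (glueEp_of_notMem q.2).symm

theorem IsPushout.symm {K G₁ G₂ M : POG} {e₁ : POGHom K G₁} {e₂ : POGHom K G₂}
    {i₁ : POGHom G₁ M} {i₂ : POGHom G₂ M} (h : IsPushout e₁ e₂ i₁ i₂) :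
    IsPushout e₂ e₁ i₂ i₁ := by
  refine ⟨h.1, h.2.1.symm, fun N hN j₂ j₁ hj => ?_⟩
  simpa only [and_comm] using h.2.2 N hN j₁ j₂ hj.symm

theorem POG.IsPointGraph.not_isBoundaryPt {K : POG} (hK : K.IsPointGraph) (p : K.Eps) :
    ¬ K.IsBoundaryPt p := by
  rintro (⟨⟨e, _⟩, _⟩ | ⟨⟨e, _⟩, _⟩) <;> exact hK.1.false e

theorem POG.IsPointGraph.isIsolated {K : POG} (hK : K.IsPointGraph) (p : K.Eps) :
    K.IsIsolated p :=
  ⟨fun ⟨e, _⟩ => hK.1.false e, fun ⟨e, _⟩ => hK.1.false e⟩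

theorem POG.IsBoundaryPt.not_isIsolated {G : POG} {p : G.Eps} (hp : G.IsBoundaryPt p) :
    ¬ G.IsIsolated p :=
  fun h => hp.elim (fun hp => h.2 hp.1) fun hp => h.1 hp.1

theorem IsPluggingAt.symm {K G₁ G₂ M : POG} {e₁ : POGHom K G₁} {e₂ : POGHom K G₂}
    {i₁ : POGHom G₁ M} {i₂ : POGHom G₂ M} (h : IsPluggingAt e₁ e₂ i₁ i₂) :
    IsPluggingAt e₂ e₁ i₂ i₁ := by
  obtain ⟨⟨hK, hG₁, hG₂, he₁, he₂, hbc, hpo⟩, hpt, hb₁, hb₂⟩ := h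
  refine ⟨⟨hK, hG₂, hG₁, he₂, he₁, ⟨fun p hp => (hpt.not_isBoundaryPt p hp).elim,
    fun p hp => ?_⟩, hpo.symm⟩, hpt, hb₂, hb₁⟩
  rcases hbc.2 p hp with h | h | ⟨h, h'⟩
  · exact Or.inr (Or.inl h)
  · exact Or.inl h
  · exact Or.inr (Or.inr ⟨h'.symm, h.symm⟩)

theorem IsPluggingAt.opposite {K G₁ G₂ M : POG} {e₁ : POGHom K G₁} {e₂ : POGHom K G₂}
    {i₁ : POGHom G₁ M} {i₂ : POGHom G₂ M} (h : IsPluggingAt e₁ e₂ i₁ i₂) (k : K.Eps) :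
    (G₁.IsInput (e₁.epMap k) ↔ G₂.IsOutput (e₂.epMap k)) ∧
      (G₁.IsOutput (e₁.epMap k) ↔ G₂.IsInput (e₂.epMap k)) := by
  obtain ⟨⟨-, -, -, -, -, hbc, -⟩, hpt, hb₁, hb₂⟩ := h
  rcases hbc.2 k (hpt.isIsolated k) with h | h | h
  · exact ((hb₁ k).not_isIsolated h).elim
  · exact ((hb₂ k).not_isIsolated h).elim
  · exact h

/-- Embeddings of a point graph at boundary points of opposite orientation can be plugged. -/
theorem isPluggingAt_glue {K G₁ G₂ : POG} {e₁ : POGHom K G₁} {e₂ : POGHom K G₂}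
    (hK : K.IsOpen) (hpt : K.IsPointGraph) (hG₁ : G₁.IsOpen) (hG₂ : G₂.IsOpen)
    (he₁ : e₁.IsEmbedding) (he₂ : e₂.IsEmbedding)
    (hb : ∀ k, G₁.IsBoundaryPt (e₁.epMap k))
    (hopp : ∀ k, (G₁.IsInput (e₁.epMap k) ↔ G₂.IsOutput (e₂.epMap k)) ∧
      (G₁.IsOutput (e₁.epMap k) ↔ G₂.IsInput (e₂.epMap k))) :
    IsPluggingAt e₁ e₂ (glueInl e₁ e₂) (glueInr e₁ e₂) := by
  have hopen : (glue e₁ e₂).IsOpen := isOpen_glue hG₁ hG₂ he₁.1.2.2 fun k =>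
    (hb k).imp (fun h => ⟨h, (hopp k).1.1 h⟩) fun h => ⟨h, (hopp k).2.1 h⟩
  exact ⟨⟨hK, hG₁, hG₂, he₁, he₂, ⟨fun p hp => (hpt.not_isBoundaryPt p hp).elim,
    fun p _ => Or.inr (Or.inr (hopp p))⟩, isPushout_glue hpt hopen he₂.1.2.2⟩, hpt, hb,
    fun k => (hb k).symm.imp (hopp k).2.1 (hopp k).1.1⟩

/-- Plugging of rewrites is a special case of sequential merging:
for every plugging `p` of rewrites `r₁ : L₁ → R₁`, `r₂ : L₂ → R₂` — given by the
parallel composition `(r₁ ⊙_p r₂) : A → B` with `A = L₁ ⊙_p L₂` and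
`B = R₁ ⊙_p R₂` — there exists merging data `q` such that `r₁ ⊙_p r₂` equals the
sequential merging `r₁ ;_q r₂`. -/
theorem rewrite_plugging_is_sequential_merging
    {L₁ R₁ L₂ R₂ P A B : POG}
    (hr₁ : IsRewrite L₁ R₁) (hr₂ : IsRewrite L₂ R₂)
    (b : POGHom P L₁) (b' : POGHom P L₂) (c : POGHom P R₁) (c' : POGHom P R₂)
    (iL₁ : POGHom L₁ A) (iL₂ : POGHom L₂ A) (iR₁ : POGHom R₁ B) (iR₂ : POGHom R₂ B)
    (hA : IsPluggingAt b b' iL₁ iL₂) (hB : IsPluggingAt c c' iR₁ iR₂)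
    (hbc : PlugCorresponds b c) (hbc' : PlugCorresponds b' c') :
    ∃ (K MM : POG) (e : POGHom K R₁) (e' : POGHom K L₂)
      (m : POGHom R₁ MM) (m' : POGHom L₂ MM),
      IsMergingAt e e' m m' ∧
      IsSubstitutionAt MM m L₁ A ∧ IsSubstitutionAt MM m' R₂ B := by
  have hM : IsPluggingAt c b' (glueInl c b') (glueInr c b') := by
    refine isPluggingAt_glue hA.1.1 hA.2.1 hB.1.2.1 hA.1.2.2.1 hB.1.2.2.2.1 hA.1.2.2.2.2.1
      hB.2.2.1 fun k => ?_
    exact ⟨(hbc k).1.symm.trans (hA.opposite k).1, (hbc k).2.symm.trans (hA.opposite k).2⟩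
  exact ⟨P, glue c b', c, b', glueInl c b', glueInr c b', hM.1,
    ⟨L₂, P, c, b', b, glueInr c b', iL₁, iL₂, hM, hA⟩,
    ⟨R₁, P, b', c, c', glueInl c b', iR₂, iR₁, hM.symm, hB.symm⟩⟩
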